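/- arXiv:1805.05071 — 6 statements merged into one kernel-verified Lean document; each statement's English description precedes it below -/
import Mathlib

section
/- Let ν be a probability distribution on [0,1] and let μ ∈ (E(ν), 1), where E(ν) denotes the mean of ν. Then K_inf(ν, μ) ≥ KL(Ber(E(ν)), Ber(μ)) ≥ 2 (E(ν) − μ)², where Ber(p) denotes the Bernoulli distribution with parameter p. In particular K_inf(ν, μ) ≥ 2 (E(ν) − μ)². -/
open MeasureTheory Real ENNReal
open scoped Classical

/-- Kullback–Leibler divergence between two measures on `ℝ`, equal to
`∫ ln(dν/dν') dν` when `ν ≪ ν'` (and this integral is well defined), and `+∞` otherwise. -/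
noncomputable def KL (ν ν' : Measure ℝ) : ℝ≥0∞ :=
  if ν ≪ ν' ∧ Integrable (fun x => Real.log ((ν.rnDeriv ν' x).toReal)) ν
  then ENNReal.ofReal (∫ x, Real.log ((ν.rnDeriv ν' x).toReal) ∂ν)
  else ⊤

/-- `K_inf(ν, x)`: infimum of `KL(ν, ν')` over probability measures `ν'` on `[0,1]`
with mean `> x`. The infimum of the empty set is `+∞`. -/
noncomputable def Kinf (ν : Measure ℝ) (x : ℝ) : ℝ≥0∞ :=
  ⨅ (ν' : Measure ℝ) (_ : IsProbabilityMeasure ν')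
    (_ : ν' (Set.Icc (0:ℝ) 1)ᶜ = 0) (_ : x < ∫ y, y ∂ν'), KL ν ν'

/-- The Bernoulli distribution with parameter `p`, as a measure on `ℝ`. -/
noncomputable def bern (p : ℝ) : Measure ℝ :=
  ENNReal.ofReal p • Measure.dirac 1 + ENNReal.ofReal (1 - p) • Measure.dirac 0

lemma aux_pinsker (p m : ℝ) (hp : 0 ≤ p) (hpm : p < m) (hm : m < 1) :
    2 * (p - m) ^ 2 ≤ p * Real.log (p / m) + (1 - p) * Real.log ((1 - p) / (1 - m)) := by
  have hmono : MonotoneOn (fun x : ℝ => p * Real.log p - p * Real.log x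
      + (1 - p) * (Real.log (1 - p) - Real.log (1 - x)) - 2 * (x - p) ^ 2) (Set.Icc p m) := by
    have hd : ∀ x ∈ interior (Set.Icc p m), HasDerivAt (fun x : ℝ => p * Real.log p - p * Real.log x
      + (1 - p) * (Real.log (1 - p) - Real.log (1 - x)) - 2 * (x - p) ^ 2)
        (0 - p * x⁻¹ + (1 - p) * (0 - (0 - 1) / (1 - x)) - 2 * (2 * (x - p))) x := by
      intro x hx
      rw [interior_Icc] at hx
      have hx0 : 0 < x := lt_of_le_of_lt hp hx.1
      have hx1 : 0 < 1 - x := by linarith [hx.2]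
      have h1 := (Real.hasDerivAt_log hx0.ne').const_mul p
      have h2 := ((hasDerivAt_const x (1:ℝ)).sub (hasDerivAt_id x)).log hx1.ne'
      have h3 := ((hasDerivAt_id x).sub_const p).pow 2
      have h4 := (((hasDerivAt_const x (p * Real.log p)).sub h1).add
        (((hasDerivAt_const x (Real.log (1 - p))).sub h2).const_mul (1 - p))).sub (h3.const_mul 2)
      refine HasDerivAt.congr_deriv (f' := _) h4 ?_
      simp only [Pi.sub_apply, id]
      norm_num
    refine monotoneOn_of_deriv_nonneg (convex_Icc p m) ?_ ?_ ?_
    · have hc : ContinuousOn (fun x : ℝ => p * Real.log x) (Set.Icc p m) := by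
        rcases hp.eq_or_lt with h | h
        · subst h
          simpa using continuousOn_const
        · exact continuousOn_const.mul (Real.continuousOn_log.mono fun x hx => by
            simp only [Set.mem_compl_iff, Set.mem_singleton_iff]
            linarith [hx.1])
      have hc2 : ContinuousOn (fun x : ℝ => Real.log (1 - x)) (Set.Icc p m) :=
        ContinuousOn.log (by fun_prop) (fun x hx => by linarith [hx.2])
      fun_prop
    · intro x hx
      exact (hd x hx).differentiableAt.differentiableWithinAt
    · intro x hx
      rw [(hd x hx).deriv]
      rw [interior_Icc] at hx
      have hx0 : 0 < x := lt_of_le_of_lt hp hx.1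
      have hx1 : 0 < 1 - x := by linarith [hx.2]
      have : (0 - p * x⁻¹ + (1 - p) * (0 - (0 - 1) / (1 - x)) - 2 * (2 * (x - p)))
          = (x - p) * (1 - 2 * x) ^ 2 / (x * (1 - x)) := by
        field_simp
        ring
      rw [this]
      have : 0 < x - p := by linarith [hx.1]
      positivity
  have h := hmono (Set.left_mem_Icc.2 hpm.le) (Set.right_mem_Icc.2 hpm.le) hpm.le
  have e2 : Real.log ((1 - p) / (1 - m)) = Real.log (1 - p) - Real.log (1 - m) :=
    Real.log_div (by linarith) (by linarith)
  have e1 : p * Real.log (p / m) = p * Real.log p - p * Real.log m := by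
    rcases hp.eq_or_lt with h | h
    · subst h; simp
    · rw [Real.log_div h.ne' (by linarith)]; ring
  rw [e1, e2]
  simp only [sub_self] at h
  nlinarith [h]

lemma aux_KL_bern (p m : ℝ) (hp : 0 ≤ p) (hpm : p < m) (hm : m < 1) :
    KL (bern p) (bern m)
      = ENNReal.ofReal (p * Real.log (p / m) + (1 - p) * Real.log ((1 - p) / (1 - m))) := by
  have hm0 : 0 < m := by linarith
  have hm1 : 0 < 1 - m := by linarith
  have hp1 : 0 < 1 - p := by linarith
  set f : ℝ → ℝ≥0∞ := fun x => if x = 1 then ENNReal.ofReal (p / m)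
    else ENNReal.ofReal ((1 - p) / (1 - m)) with hf
  have hfm : Measurable f := Measurable.ite (measurableSet_singleton 1) measurable_const
    measurable_const
  have : IsFiniteMeasure (bern m) := by
    constructor
    simp [bern]
  have hw : bern p = (bern m).withDensity f := by
    ext s hs
    rw [withDensity_apply _ hs, ← lintegral_indicator hs]
    simp only [bern, lintegral_add_measure, lintegral_smul_measure, lintegral_dirac,
      Measure.add_apply, Measure.smul_apply, Measure.dirac_apply' _ hs, Set.indicator, hf]
    have e1 : ENNReal.ofReal m * ENNReal.ofReal (p / m) = ENNReal.ofReal p := by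
      rw [← ENNReal.ofReal_mul hm0.le]; congr 1; field_simp
    have e2 : ENNReal.ofReal (1 - m) * ENNReal.ofReal ((1 - p) / (1 - m))
        = ENNReal.ofReal (1 - p) := by
      rw [← ENNReal.ofReal_mul hm1.le]; congr 1; field_simp
    by_cases h1 : (1:ℝ) ∈ s <;> by_cases h0 : (0:ℝ) ∈ s <;> simp [h1, h0, e1, e2]
  have hac : bern p ≪ bern m := hw ▸ withDensity_absolutelyContinuous _ _
  have hr : (bern p).rnDeriv (bern m) =ᵐ[bern m] f := by
    rw [hw]; exact Measure.rnDeriv_withDensity _ hfm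
  have hr' := hac.ae_le hr
  have hl : (fun x => Real.log (((bern p).rnDeriv (bern m) x).toReal)) =ᵐ[bern p]
      fun x => Real.log (f x).toReal := by
    filter_upwards [hr'] with x hx
    rw [hx]
  have hlm : Measurable fun x => Real.log (f x).toReal := by fun_prop
  have hi1 : Integrable (fun x => Real.log (f x).toReal)
      (ENNReal.ofReal p • Measure.dirac (1:ℝ)) :=
    (integrable_dirac (by simp)).smul_measure (by simp)
  have hi0 : Integrable (fun x => Real.log (f x).toReal)
      (ENNReal.ofReal (1 - p) • Measure.dirac (0:ℝ)) :=
    (integrable_dirac (by simp)).smul_measure (by simp)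
  have hi : Integrable (fun x => Real.log (f x).toReal) (bern p) := hi1.add_measure hi0
  rw [KL, if_pos ⟨hac, (integrable_congr hl).2 hi⟩, integral_congr_ae hl]
  congr 1
  conv_lhs => rw [bern]
  rw [integral_add_measure hi1 hi0]
  simp only [integral_smul_measure, integral_dirac, hf, smul_eq_mul]
  rw [ENNReal.toReal_ofReal hp, ENNReal.toReal_ofReal hp1.le]
  simp only [if_true, zero_ne_one, if_false]
  rw [ENNReal.toReal_ofReal (by positivity), ENNReal.toReal_ofReal (by positivity)]

lemma aux_int (ν : Measure ℝ) [IsProbabilityMeasure ν] (h : ∀ᵐ x ∂ν, x ∈ Set.Icc (0:ℝ) 1) :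
    Integrable (fun y : ℝ => y) ν := by
  refine Integrable.of_bound measurable_id.aestronglyMeasurable 1 ?_
  filter_upwards [h] with x hx
  rw [Real.norm_eq_abs, abs_le]
  constructor <;> linarith [hx.1, hx.2]

lemma aux_affine (ν : Measure ℝ) [IsProbabilityMeasure ν] (h : ∀ᵐ x ∂ν, x ∈ Set.Icc (0:ℝ) 1)
    (a b : ℝ) : Integrable (fun y : ℝ => y * a + (1 - y) * b) ν ∧
      ∫ y, (y * a + (1 - y) * b) ∂ν = (∫ y, y ∂ν) * a + (1 - ∫ y, y ∂ν) * b := by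
  have hi := aux_int ν h
  have h1 : Integrable (fun y : ℝ => y * a) ν := hi.mul_const a
  have h2' : Integrable (fun y : ℝ => 1 - y) ν := (integrable_const (1:ℝ)).sub hi
  have h2 : Integrable (fun y : ℝ => (1 - y) * b) ν := h2'.mul_const b
  refine ⟨h1.add h2, ?_⟩
  rw [integral_add h1 h2, integral_mul_const, integral_mul_const,
    integral_sub (integrable_const _) hi]
  simp

lemma aux_pt (a b x r : ℝ) (ha : 0 < a) (hb : 0 < b) (hx : x ∈ Set.Icc (0:ℝ) 1) (hr : 0 < r) :
    x * Real.log a + (1 - x) * Real.log b + 1 - (x * a + (1 - x) * b) / r ≤ Real.log r := by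
  have h1 := strictConcaveOn_log_Ioi.concaveOn.2 (Set.mem_Ioi.2 ha) (Set.mem_Ioi.2 hb) hx.1
    (sub_nonneg.2 hx.2) (by ring)
  simp only [smul_eq_mul] at h1
  have hpos : 0 < x * a + (1 - x) * b := by
    rcases hx.1.eq_or_lt with h | h
    · rw [← h]; simpa using hb
    · have : 0 < x * a := by positivity
      have := mul_nonneg (sub_nonneg.2 hx.2) hb.le
      linarith
  have h2 := Real.log_le_sub_one_of_pos (div_pos hpos hr)
  rw [Real.log_div hpos.ne' hr.ne'] at h2
  linarith

lemma aux_main (ν ν' : Measure ℝ) [IsProbabilityMeasure ν] [IsProbabilityMeasure ν']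
    (h : ∀ᵐ x ∂ν, x ∈ Set.Icc (0:ℝ) 1) (h' : ∀ᵐ x ∂ν', x ∈ Set.Icc (0:ℝ) 1)
    (m : ℝ) (hp : 0 ≤ ∫ y, y ∂ν) (hpm : ∫ y, y ∂ν < m) (hm : m < 1) (hq : m < ∫ y, y ∂ν')
    (hac : ν ≪ ν') (hint : Integrable (fun x => Real.log ((ν.rnDeriv ν' x).toReal)) ν) :
    (∫ y, y ∂ν) * Real.log ((∫ y, y ∂ν) / m)
      + (1 - ∫ y, y ∂ν) * Real.log ((1 - ∫ y, y ∂ν) / (1 - m))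
      ≤ ∫ x, Real.log ((ν.rnDeriv ν' x).toReal) ∂ν := by
  set p := ∫ y, y ∂ν with hpdef
  set q := ∫ y, y ∂ν' with hqdef
  have hm0 : 0 < m := by linarith
  have hm1 : 0 < 1 - m := by linarith
  have hp1 : 0 < 1 - p := by linarith
  set a := p / m with ha
  set b := (1 - p) / (1 - m) with hb
  have hb0 : 0 < b := by positivity
  have ha0 : 0 ≤ a := by positivity
  obtain ⟨hφi, hφ⟩ := aux_affine ν h (Real.log a) (Real.log b)
  obtain ⟨hψi, hψ⟩ := aux_affine ν' h' a b
  have hψ1 : q * a + (1 - q) * b ≤ 1 := by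
    have e : m * a + (1 - m) * b = 1 := by rw [ha, hb]; field_simp; ring
    have hab : a ≤ b := by
      rw [ha, hb, div_le_div_iff₀ hm0 hm1]; nlinarith
    nlinarith
  set g : ℝ → ℝ := fun x => (x * a + (1 - x) * b) / (ν.rnDeriv ν' x).toReal with hg
  have hrm : Measurable fun x => (ν.rnDeriv ν' x).toReal :=
    (Measure.measurable_rnDeriv ν ν').ennreal_toReal
  have hgm : Measurable g := by
    have : Measurable fun x : ℝ => x * a + (1 - x) * b := by fun_prop
    exact this.div hrm
  have hle : ∀ᵐ x ∂ν', 0 ≤ (ν.rnDeriv ν' x).toReal • g x ∧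
      (ν.rnDeriv ν' x).toReal • g x ≤ x * a + (1 - x) * b := by
    filter_upwards [h'] with x hx
    have : 0 ≤ x * a + (1 - x) * b :=
      add_nonneg (mul_nonneg hx.1 ha0) (mul_nonneg (sub_nonneg.2 hx.2) hb0.le)
    by_cases hr : (ν.rnDeriv ν' x).toReal = 0
    · rw [hr]; simpa using this
    · rw [hg, smul_eq_mul, mul_div_cancel₀ _ hr]
      exact ⟨this, le_rfl⟩
  have hgi' : Integrable (fun x => (ν.rnDeriv ν' x).toReal • g x) ν' := by
    refine hψi.mono' (hrm.smul hgm).aestronglyMeasurable ?_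
    filter_upwards [hle] with x hx
    rw [Real.norm_eq_abs, abs_of_nonneg hx.1]
    exact hx.2
  have hgi : Integrable g ν := (integrable_rnDeriv_smul_iff hac).1 hgi'
  have hg1 : ∫ x, g x ∂ν ≤ 1 := by
    rw [← integral_rnDeriv_smul hac]
    calc _ ≤ ∫ x, (x * a + (1 - x) * b) ∂ν' :=
          integral_mono_ae hgi' hψi (hle.mono fun x hx => hx.2)
      _ ≤ 1 := by rw [hψ]; exact hψ1
  have hpos : ∀ᵐ x ∂ν, 0 < (ν.rnDeriv ν' x).toReal := by
    filter_upwards [Measure.rnDeriv_pos hac, hac.ae_le (Measure.rnDeriv_ne_top ν ν')] with x h1 h2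
    exact ENNReal.toReal_pos h1.ne' h2
  have hz : p = 0 → ∀ᵐ x ∂ν, x = 0 := by
    intro h0
    exact (integral_eq_zero_iff_of_nonneg_ae (h.mono fun x hx => hx.1) (aux_int ν h)).1 h0
  have hpt : ∀ᵐ x ∂ν, (x * Real.log a + (1 - x) * Real.log b) + 1 - g x
      ≤ Real.log ((ν.rnDeriv ν' x).toReal) := by
    rcases hp.eq_or_lt with h0 | h0
    · filter_upwards [hz h0.symm, hpos] with x hx hr
      have := aux_pt 1 b 0 _ one_pos hb0 ⟨le_rfl, zero_le_one⟩ hr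
      simp only [hg]
      rw [hx] at this ⊢
      simpa using this
    · filter_upwards [h, hpos] with x hx hr
      exact aux_pt a b x _ (by positivity) hb0 hx hr
  have hfin := integral_mono_ae ((hφi.add (integrable_const (1:ℝ))).sub hgi) hint hpt
  have e : ∫ x, ((fun y : ℝ => y * Real.log a + (1 - y) * Real.log b) + (fun _ : ℝ => (1:ℝ)) - g : ℝ → ℝ) x ∂ν
      = p * Real.log a + (1 - p) * Real.log b + 1 - ∫ x, g x ∂ν := by
    rw [integral_sub' (hφi.add (integrable_const (1:ℝ))) hgi,
      integral_add' hφi (integrable_const (1:ℝ)), hφ]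
    simp [hpdef]
  rw [e] at hfin
  linarith

/-- For a probability distribution `ν` on `[0,1]` and `μ ∈ (E(ν), 1)`, one has
`K_inf(ν, μ) ≥ KL(Ber(E(ν)), Ber(μ)) ≥ 2 (E(ν) − μ)²`. -/
theorem kinf_ge_kl_bern_ge_pinsker (ν : Measure ℝ) [IsProbabilityMeasure ν]
    (hsupp : ν (Set.Icc (0:ℝ) 1)ᶜ = 0)
    (μ : ℝ) (hμ : μ ∈ Set.Ioo (∫ y, y ∂ν) 1) :
    KL (bern (∫ y, y ∂ν)) (bern μ) ≤ Kinf ν μ ∧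
      ENNReal.ofReal (2 * ((∫ y, y ∂ν) - μ) ^ 2) ≤ KL (bern (∫ y, y ∂ν)) (bern μ) := by
  have h : ∀ᵐ x ∂ν, x ∈ Set.Icc (0:ℝ) 1 := mem_ae_iff.2 hsupp
  have hp : 0 ≤ ∫ y, y ∂ν := integral_nonneg_of_ae (h.mono fun x hx => hx.1)
  rw [aux_KL_bern _ _ hp hμ.1 hμ.2]
  refine ⟨?_, ENNReal.ofReal_le_ofReal (aux_pinsker _ _ hp hμ.1 hμ.2)⟩
  unfold Kinf
  refine le_iInf fun ν' => le_iInf fun hν' => le_iInf fun hs => le_iInf fun hq => ?_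
  unfold KL
  split_ifs with hc
  · exact ENNReal.ofReal_le_ofReal
      (aux_main ν ν' h (mem_ae_iff.2 hs) μ hp hμ.1 hμ.2 hq hc.1 hc.2)
  · exact le_top
end

section
/- Let ν be a probability distribution on [0,1] and let μ ∈ (0,1). Then for all ε ∈ [0, μ], one has K_inf(ν, μ) ≤ K_inf(ν, μ − ε) + ε / (1 − μ). -/
open MeasureTheory Real ENNReal
open scoped Classical

lemma KL_mix_le (ν ν' : Measure ℝ) [IsProbabilityMeasure ν] [IsProbabilityMeasure ν']
    (ρ : Measure ℝ) [IsFiniteMeasure ρ] (c : ℝ) (hc : 0 < c) (b : ℝ) (hb : - Real.log c ≤ b) :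
    KL ν (ENNReal.ofReal c • ν' + ρ) ≤ KL ν ν' + ENNReal.ofReal b := by
  by_cases h : ν ≪ ν' ∧ Integrable (fun x => Real.log ((ν.rnDeriv ν' x).toReal)) ν
  swap
  · simp [KL, h]
  obtain ⟨hac, hint⟩ := h
  have hc0 : ENNReal.ofReal c ≠ 0 := by simpa using hc
  haveI : IsFiniteMeasure (ENNReal.ofReal c • ν') := Measure.smul_finite _ ENNReal.ofReal_ne_top
  set ν'' := ENNReal.ofReal c • ν' + ρ with hν''
  have hac' : ν ≪ ν'' := by
    intro s hs
    apply hac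
    simp [hν'', hc] at hs
    exact hs.1.resolve_left (not_le.mpr hc)
  have e1 := Measure.inv_rnDeriv hac
  have e2 := Measure.inv_rnDeriv hac'
  have e3 := Measure.rnDeriv_add (ENNReal.ofReal c • ν') ρ ν
  have e4 := Measure.rnDeriv_smul_left_of_ne_top ν' ν (ENNReal.ofReal_ne_top (r := c))
  have p1 := Measure.rnDeriv_pos hac
  have f1 := hac (Measure.rnDeriv_lt_top ν ν')
  have f2 := Measure.rnDeriv_lt_top ν'' ν
  have key : ∀ᵐ x ∂ν, Real.log (ν.rnDeriv ν'' x).toReal ≤ Real.log (ν.rnDeriv ν' x).toReal + b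
      ∧ -(ν''.rnDeriv ν x).toReal ≤ Real.log (ν.rnDeriv ν'' x).toReal := by
    filter_upwards [e1, e2, e3, e4, p1, f1, f2] with x e1 e2 e3 e4 p1 f1 f2
    simp only [Pi.inv_apply, Pi.add_apply, Pi.smul_apply, smul_eq_mul] at e1 e2 e3 e4
    have hr : ν.rnDeriv ν'' x = (ν''.rnDeriv ν x)⁻¹ := by rw [← e2, inv_inv]
    have hr' : ν.rnDeriv ν' x = (ν'.rnDeriv ν x)⁻¹ := by rw [← e1, inv_inv]
    have hg0 : 0 < (ν'.rnDeriv ν x).toReal := by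
      rw [← e1, ENNReal.toReal_inv]
      exact inv_pos.mpr (ENNReal.toReal_pos p1.ne' f1.ne)
    have hle : c * (ν'.rnDeriv ν x).toReal ≤ (ν''.rnDeriv ν x).toReal := by
      have : ENNReal.ofReal c * ν'.rnDeriv ν x ≤ ν''.rnDeriv ν x := by
        rw [e3, e4]; exact le_self_add
      have := ENNReal.toReal_mono f2.ne this
      rwa [ENNReal.toReal_mul, ENNReal.toReal_ofReal hc.le] at this
    have hh0 := (mul_pos hc hg0).trans_le hle
    rw [hr, hr', ENNReal.toReal_inv, ENNReal.toReal_inv, Real.log_inv, Real.log_inv]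
    have l1 := Real.log_le_log (mul_pos hc hg0) hle
    rw [Real.log_mul hc.ne' hg0.ne'] at l1
    have l2 := Real.log_le_sub_one_of_pos hh0
    constructor <;> linarith
  have hup : Integrable (fun x => Real.log (ν.rnDeriv ν' x).toReal + b) ν :=
    hint.add (integrable_const b)
  have hint' : Integrable (fun x => Real.log ((ν.rnDeriv ν'' x).toReal)) ν := by
    refine integrable_of_le_of_le
      (Measure.measurable_rnDeriv ν ν'').ennreal_toReal.log.aestronglyMeasurable (key.mono fun x h => h.2) (key.mono fun x h => h.1)
      ?_ hup
    exact Measure.integrable_toReal_rnDeriv.neg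
  rw [KL, KL, if_pos ⟨hac', hint'⟩, if_pos ⟨hac, hint⟩]
  refine le_trans (ENNReal.ofReal_le_ofReal ?_) ENNReal.ofReal_add_le
  refine (integral_mono_ae hint' hup (key.mono fun x h => h.1)).trans_eq ?_
  rw [integral_add hint (integrable_const b)]
  simp

theorem kinf_upper_regularity (ν : Measure ℝ) [IsProbabilityMeasure ν]
    (hsupp : ν (Set.Icc (0:ℝ) 1)ᶜ = 0)
    (μ : ℝ) (hμ : μ ∈ Set.Ioo (0:ℝ) 1)
    (ε : ℝ) (hε : ε ∈ Set.Icc 0 μ) :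
    Kinf ν μ ≤ Kinf ν (μ - ε) + ENNReal.ofReal (ε / (1 - μ)) := by
  obtain ⟨h0, h1⟩ := hμ
  obtain ⟨hε0, hεμ⟩ := hε
  have hd : 0 < 1 - μ := by linarith
  have hd' : 0 < 1 - μ + ε := by linarith
  obtain ⟨c, hcdef⟩ : ∃ c, c = (1 - μ) / (1 - μ + ε) := ⟨_, rfl⟩
  have hc : 0 < c := hcdef ▸ div_pos hd hd'
  have hcm : c * (1 - μ + ε) = 1 - μ := by rw [hcdef]; field_simp
  have hc1 : c ≤ 1 := by rw [hcdef, div_le_one hd']; linarith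
  have hlog : - Real.log c ≤ ε / (1 - μ) := by
    have := Real.log_le_sub_one_of_pos (inv_pos.mpr hc)
    rw [Real.log_inv] at this
    refine this.trans_eq ?_
    rw [hcdef]; field_simp; ring
  rw [Kinf, Kinf]
  simp only [ENNReal.iInf_add]
  refine le_iInf fun ν' => le_iInf fun hP => le_iInf fun hs => le_iInf fun hm => ?_
  haveI : IsFiniteMeasure (ENNReal.ofReal (1 - c) • Measure.dirac (1:ℝ)) :=
    Measure.smul_finite _ ENNReal.ofReal_ne_top
  refine le_trans ?_ (KL_mix_le ν ν' (ENNReal.ofReal (1 - c) • Measure.dirac (1:ℝ)) c hc _ hlog)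
  refine iInf_le_of_le _ (iInf_le_of_le ?_ (iInf_le_of_le ?_ (iInf_le_of_le ?_ le_rfl)))
  · constructor
    simp [← ENNReal.ofReal_add hc.le (sub_nonneg.mpr hc1)]
  · simp [hs]
  · have hi : Integrable (fun y : ℝ => y) ν' := by
      refine Integrable.of_bound (by fun_prop) 1 ?_
      have : ∀ᵐ x ∂ν', x ∈ Set.Icc (0:ℝ) 1 := hs
      filter_upwards [this] with x hx
      rw [Real.norm_eq_abs, abs_le]; constructor <;> linarith [hx.1, hx.2]
    have hi2 : Integrable (fun y : ℝ => y) (Measure.dirac (1:ℝ)) :=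
      integrable_dirac (by simp)
    rw [integral_add_measure (hi.smul_measure ENNReal.ofReal_ne_top)
      (hi2.smul_measure ENNReal.ofReal_ne_top), integral_smul_measure, integral_smul_measure,
      integral_dirac, ENNReal.toReal_ofReal hc.le, ENNReal.toReal_ofReal (sub_nonneg.mpr hc1)]
    simp only [smul_eq_mul]
    nlinarith [mul_lt_mul_of_pos_left hm hc]
end

section
/- Let ν be a probability distribution on [0,1]. Then the function μ ↦ K_inf(ν, μ) is left-continuous on (0,1). In particular: (i) K_inf(ν, E(ν)) = 0 whenever E(ν) ∈ (0,1); and (ii) for all μ ∈ (0,1), K_inf(ν, μ) = inf{ KL(ν, ν') : ν' a probability distribution on [0,1] with E(ν') ≥ μ }. -/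
open MeasureTheory Real ENNReal
open scoped Classical

lemma KL_mix (ν ν' : Measure ℝ) [IsProbabilityMeasure ν] [IsProbabilityMeasure ν']
    (ν'' : Measure ℝ) [IsProbabilityMeasure ν''] (d : ℝ) (hd : 0 < d)
    (hle : ENNReal.ofReal (Real.exp (-d)) • ν' ≤ ν'') :
    KL ν ν'' ≤ KL ν ν' + ENNReal.ofReal d := by
  by_cases h : ν ≪ ν' ∧ Integrable (fun x => Real.log ((ν.rnDeriv ν' x).toReal)) ν
  swap
  · simp [KL, h]
  obtain ⟨hac, hint⟩ := h
  set c := ENNReal.ofReal (Real.exp (-d)) with hc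
  have hc0 : c ≠ 0 := by simp [hc, Real.exp_pos]
  have hct : c ≠ ⊤ := ENNReal.ofReal_ne_top
  have hac' : ν' ≪ ν'' := by
    refine Measure.AbsolutelyContinuous.mk fun s hs h0 => ?_
    have := hle s
    rw [h0] at this
    simpa [hc0] using this
  have hac'' : ν ≪ ν'' := hac.trans hac'
  have h1 : ∀ᵐ x ∂ν, c * ν'.rnDeriv ν'' x ≤ 1 := by
    apply hac''.ae_le
    have a1 := Measure.rnDeriv_le_one_of_le hle
    have a2 := Measure.rnDeriv_smul_left_of_ne_top ν' ν'' hct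
    filter_upwards [a1, a2] with x h1 h2
    rw [h2] at h1
    simpa using h1
  have h2 := hac''.ae_le (Measure.rnDeriv_mul_rnDeriv (μ := ν) (ν := ν') (κ := ν'') hac)
  have h3 := Measure.rnDeriv_pos hac''
  have h3' := Measure.rnDeriv_pos hac
  have h4 := hac''.ae_le (Measure.rnDeriv_lt_top ν ν'')
  have h4' := hac.ae_le (Measure.rnDeriv_lt_top ν ν')
  have h5 := Measure.inv_rnDeriv hac''
  have hup : ∀ᵐ x ∂ν, Real.log ((ν.rnDeriv ν'' x).toReal) ≤
      Real.log ((ν.rnDeriv ν' x).toReal) + d := by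
    filter_upwards [h1, h2, h3, h3', h4, h4'] with x h1 h2 h3 h3' h4 h4'
    have e1 : 0 < (ν.rnDeriv ν'' x).toReal := ENNReal.toReal_pos h3.ne' h4.ne
    have e2 : 0 < (ν.rnDeriv ν' x).toReal := ENNReal.toReal_pos h3'.ne' h4'.ne
    have e3 : c * ν.rnDeriv ν'' x ≤ ν.rnDeriv ν' x := by
      rw [← h2, Pi.mul_apply]
      calc c * (ν.rnDeriv ν' x * ν'.rnDeriv ν'' x)
          = ν.rnDeriv ν' x * (c * ν'.rnDeriv ν'' x) := by ring
        _ ≤ ν.rnDeriv ν' x * 1 := by gcongr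
        _ = _ := mul_one _
    have e4 := ENNReal.toReal_mono h4'.ne e3
    rw [ENNReal.toReal_mul, hc, ENNReal.toReal_ofReal (Real.exp_pos _).le] at e4
    have e5 := Real.log_le_log (by positivity) e4
    rw [Real.log_mul (Real.exp_pos _).ne' e1.ne', Real.log_exp] at e5
    linarith
  have hlow : ∀ᵐ x ∂ν, 1 - (ν''.rnDeriv ν x).toReal ≤ Real.log ((ν.rnDeriv ν'' x).toReal) := by
    filter_upwards [h3, h4, h5] with x h3 h4 h5
    have e1 : 0 < (ν.rnDeriv ν'' x).toReal := ENNReal.toReal_pos h3.ne' h4.ne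
    rw [← h5, Pi.inv_apply, ENNReal.toReal_inv]
    exact Real.one_sub_inv_le_log_of_pos e1
  have hintu : Integrable (fun x => Real.log ((ν.rnDeriv ν' x).toReal) + d) ν :=
    hint.add (integrable_const d)
  have hintl : Integrable (fun x => 1 - (ν''.rnDeriv ν x).toReal) ν :=
    (integrable_const 1).sub Measure.integrable_toReal_rnDeriv
  have hint' : Integrable (fun x => Real.log ((ν.rnDeriv ν'' x).toReal)) ν := by
    refine integrable_of_le_of_le ?_ hlow hup hintl hintu
    exact (Measure.measurable_rnDeriv ν ν'').ennreal_toReal.log.aestronglyMeasurable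
  rw [KL, KL, if_pos ⟨hac'', hint'⟩, if_pos ⟨hac, hint⟩]
  have := integral_mono_ae hint' hintu hup
  rw [integral_add hint (integrable_const d)] at this
  simp only [integral_const, probReal_univ, one_smul] at this
  exact (ENNReal.ofReal_le_ofReal this).trans ENNReal.ofReal_add_le

lemma Kinf_le_of_mean (ν ν' : Measure ℝ) [IsProbabilityMeasure ν] [IsProbabilityMeasure ν']
    (hs : ν' (Set.Icc (0:ℝ) 1)ᶜ = 0) (d μ : ℝ) (hd : 0 < d)
    (hm : μ < Real.exp (-d) * (∫ y, y ∂ν') + (1 - Real.exp (-d))) :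
    Kinf ν μ ≤ KL ν ν' + ENNReal.ofReal d := by
  set c := Real.exp (-d) with hc
  have hc0 : 0 < c := Real.exp_pos _
  have hc1 : c < 1 := by rw [hc, Real.exp_lt_one_iff]; linarith
  let ν'' : Measure ℝ := ENNReal.ofReal c • ν' + ENNReal.ofReal (1 - c) • Measure.dirac 1
  have hp : IsProbabilityMeasure ν'' := ⟨by
    simp only [ν'', Measure.add_apply, Measure.smul_apply, measure_univ, smul_eq_mul, mul_one]
    rw [← ENNReal.ofReal_add hc0.le (by linarith)]
    simp⟩
  have hle : ENNReal.ofReal c • ν' ≤ ν'' := Measure.le_add_right le_rfl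
  have hs'' : ν'' (Set.Icc (0:ℝ) 1)ᶜ = 0 := by
    simp [ν'', hs]
  have hi : Integrable (fun y : ℝ => y) ν' := by
    refine Integrable.of_bound (C := 1) measurable_id.aestronglyMeasurable ?_
    have : ∀ᵐ y ∂ν', y ∈ Set.Icc (0:ℝ) 1 := hs
    filter_upwards [this] with y hy
    rw [Real.norm_eq_abs, abs_le]
    constructor <;> linarith [hy.1, hy.2]
  have hmean : ∫ y, y ∂ν'' = c * (∫ y, y ∂ν') + (1 - c) := by
    rw [integral_add_measure (hi.smul_measure ENNReal.ofReal_ne_top)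
      ((integrable_dirac (by simp)).smul_measure ENNReal.ofReal_ne_top),
      integral_smul_measure, integral_smul_measure, integral_dirac,
      ENNReal.toReal_ofReal hc0.le, ENNReal.toReal_ofReal (by linarith)]
    simp
  refine le_trans ?_ (KL_mix ν ν' ν'' d hd hle)
  exact iInf_le_of_le ν'' (iInf_le_of_le hp (iInf_le_of_le hs''
    (iInf_le_of_le (by rw [hmean]; exact hm) le_rfl)))

lemma Kinf_mono (ν : Measure ℝ) : Monotone (Kinf ν) := by
  intro a b hab
  refine le_iInf fun ν' => le_iInf fun hp => le_iInf fun hs => le_iInf fun hm => ?_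
  exact iInf_le_of_le ν' (iInf_le_of_le hp (iInf_le_of_le hs
    (iInf_le_of_le (hab.trans_lt hm) le_rfl)))

lemma Kinf_le_add (ν : Measure ℝ) [IsProbabilityMeasure ν] (d μ m : ℝ) (hd : 0 < d)
    (hm : μ < Real.exp (-d) * m + (1 - Real.exp (-d))) :
    Kinf ν μ ≤ Kinf ν m + ENNReal.ofReal d := by
  conv_rhs => rw [Kinf]
  simp only [ENNReal.iInf_add]
  refine le_iInf fun ν' => le_iInf fun hp => le_iInf fun hs => le_iInf fun hm' => ?_
  refine Kinf_le_of_mean ν ν' hs d μ hd (hm.trans ?_)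
  have := mul_lt_mul_of_pos_left hm' (Real.exp_pos (-d))
  linarith

lemma Kinf_eq (ν : Measure ℝ) [IsProbabilityMeasure ν] (μ : ℝ) (hμ : μ ∈ Set.Ioo (0:ℝ) 1) :
    Kinf ν μ = ⨅ (ν' : Measure ℝ) (_ : IsProbabilityMeasure ν')
        (_ : ν' (Set.Icc (0:ℝ) 1)ᶜ = 0) (_ : μ ≤ ∫ y, y ∂ν'), KL ν ν' := by
  apply le_antisymm
  · refine le_iInf fun ν' => le_iInf fun hp => le_iInf fun hs => le_iInf fun hm => ?_
    refine ENNReal.le_of_forall_pos_le_add fun d hd _ => ?_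
    have hd' : (0:ℝ) < d := hd
    have := Kinf_le_of_mean ν ν' hs d μ hd' ?_
    · simpa using this
    have h1 : Real.exp (-(d:ℝ)) < 1 := by rw [Real.exp_lt_one_iff]; linarith
    have h2 := mul_le_mul_of_nonneg_left hm (Real.exp_pos (-(d:ℝ))).le
    nlinarith [hμ.2]
  · refine le_iInf fun ν' => le_iInf fun hp => le_iInf fun hs => le_iInf fun hm => ?_
    exact iInf_le_of_le ν' (iInf_le_of_le hp (iInf_le_of_le hs
      (iInf_le_of_le hm.le le_rfl)))

lemma KL_self (ν : Measure ℝ) [IsProbabilityMeasure ν] : KL ν ν = 0 := by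
  have h : (fun x => Real.log ((ν.rnDeriv ν x).toReal)) =ᵐ[ν] fun _ => 0 := by
    filter_upwards [Measure.rnDeriv_self ν] with x hx
    simp [hx]
  unfold KL
  rw [if_pos ⟨Measure.AbsolutelyContinuous.rfl, (integrable_congr h).2 (integrable_const 0)⟩,
    integral_congr_ae h]
  simp

/-- For a probability distribution `ν` on `[0,1]`: `μ ↦ K_inf(ν, μ)` is left-continuous
on `(0,1)`; in particular `K_inf(ν, E(ν)) = 0` when `E(ν) ∈ (0,1)`, and for `μ ∈ (0,1)`
the infimum defining `K_inf(ν, μ)` can be taken over `ν'` with mean `≥ μ`. -/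
theorem kinf_left_continuous (ν : Measure ℝ) [IsProbabilityMeasure ν]
    (hsupp : ν (Set.Icc (0:ℝ) 1)ᶜ = 0) :
    (∀ μ ∈ Set.Ioo (0:ℝ) 1, ContinuousWithinAt (fun m => Kinf ν m) (Set.Iic μ) μ) ∧
    ((∫ y, y ∂ν) ∈ Set.Ioo (0:ℝ) 1 → Kinf ν (∫ y, y ∂ν) = 0) ∧
    (∀ μ ∈ Set.Ioo (0:ℝ) 1,
      Kinf ν μ = ⨅ (ν' : Measure ℝ) (_ : IsProbabilityMeasure ν')
        (_ : ν' (Set.Icc (0:ℝ) 1)ᶜ = 0) (_ : μ ≤ ∫ y, y ∂ν'), KL ν ν') := by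
  refine ⟨?_, ?_, fun μ hμ => Kinf_eq ν μ hμ⟩
  · intro μ hμ
    refine tendsto_order.2 ⟨fun a ha => ?_, fun a ha => ?_⟩
    · obtain ⟨d, hd, hda⟩ := ENNReal.lt_iff_exists_add_pos_lt.1 ha
      have hd' : (0:ℝ) < d := hd
      have h1 : Real.exp (-(d:ℝ)) < 1 := by rw [Real.exp_lt_one_iff]; linarith
      have hlim : Filter.Tendsto
          (fun m : ℝ => Real.exp (-(d:ℝ)) * m + (1 - Real.exp (-(d:ℝ)))) (nhds μ)
          (nhds (Real.exp (-(d:ℝ)) * μ + (1 - Real.exp (-(d:ℝ))))) :=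
        Continuous.tendsto (by fun_prop) μ
      have hev := hlim.eventually (lt_mem_nhds (a := μ) (by nlinarith [hμ.2]))
      filter_upwards [nhdsWithin_le_nhds hev] with m hm
      have := Kinf_le_add ν d μ m hd' hm
      rw [ENNReal.ofReal_coe_nnreal] at this
      exact lt_of_add_lt_add_right (hda.trans_le this)
    · filter_upwards [self_mem_nhdsWithin] with m hm
      exact (Kinf_mono ν hm).trans_lt ha
  · intro h
    rw [Kinf_eq ν _ h]
    refine le_antisymm ?_ (zero_le)
    refine le_trans ?_ (KL_self ν).le
    exact iInf_le_of_le ν (iInf_le_of_le inferInstance (iInf_le_of_le hsupp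
      (iInf_le_of_le le_rfl le_rfl)))
end

section
/- Let φ : (0, +∞) → [0, +∞) be a non-decreasing function that vanishes on (0,1]. Then for all integers K ≥ 1 and T ≥ K, Σ_{n=1}^{⌊T/K⌋} √( (1/(2n)) φ(T/(Kn)) ) ≤ √(T/(2K)) · ∫_1^{+∞} u^{−3/2} √(φ(u)) du. -/
open MeasureTheory Real ENNReal
open scoped Classical

lemma aux_rpow (c : ℝ) (hc : 0 < c) : c ^ (-(3:ℝ)/2 + 1) = 1 / √c := by
  rw [show -(3:ℝ)/2 + 1 = -(1/2) by norm_num, Real.rpow_neg hc.le, Real.sqrt_eq_rpow]; simp only [one_div]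

lemma aux_piece (φ : ℝ → ℝ) (hmono : MonotoneOn φ (Set.Ioi (0:ℝ)))
    (c : ℝ) (hc : 0 < c) (S : Set ℝ) (hS : MeasurableSet S) (hSc : S ⊆ Set.Ioi c) (I : ℝ)
    (hint : ∫ u in S, u ^ (-(3:ℝ)/2) = I) :
    ENNReal.ofReal (√(φ c) * I) ≤
      ∫⁻ u in S, ENNReal.ofReal (u ^ (-(3:ℝ)/2) * Real.sqrt (φ u)) := by
  have hI : IntegrableOn (fun u : ℝ => u ^ (-(3:ℝ)/2)) S :=
    (integrableOn_Ioi_rpow_of_lt (by norm_num) hc).mono_set hSc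
  have hnn : 0 ≤ᵐ[volume.restrict S] (fun u : ℝ => √(φ c) * u ^ (-(3:ℝ)/2)) := by
    filter_upwards [ae_restrict_mem hS] with u hu
    have : 0 < u := hc.trans (hSc hu)
    simp only [Pi.zero_apply]
    positivity
  rw [← hint, ← integral_const_mul, ofReal_integral_eq_lintegral_ofReal (hI.const_mul _) hnn]
  refine setLIntegral_mono' hS fun u hu => ENNReal.ofReal_le_ofReal ?_
  have hu0 : 0 < u := hc.trans (hSc hu)
  rw [mul_comm]
  exact mul_le_mul_of_nonneg_left
    (Real.sqrt_le_sqrt (hmono hc hu0 (hSc hu).le)) (by positivity)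

lemma aux_term (a m p x : ℝ) (ha : 0 < a) (hm : 0 < m) (hp : 0 ≤ p) (hmp : m = p + 1) 
    (hx : 0 ≤ x) :
    √(1 / (2 * m) * x) ≤ √(a / 2) * (√x * (2 * (√m - √p) / √a)) := by
  have h1 : √(1 / (2 * m) * x) = √x / (√2 * √m) := by
    rw [one_div_mul_eq_div, Real.sqrt_div hx, Real.sqrt_mul (by norm_num)]
  have hsa : 0 < √a := Real.sqrt_pos.2 ha
  have hsm : 0 < √m := Real.sqrt_pos.2 hm
  have h2 : √(a / 2) * (√x * (2 * (√m - √p) / √a)) = √x / √2 * (2 * (√m - √p)) := by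
    rw [Real.sqrt_div ha.le]; field_simp
  rw [h1, h2, ← div_div, div_eq_mul_inv (√x / √2)]
  refine mul_le_mul_of_nonneg_left ?_ (by positivity)
  rw [inv_le_iff_one_le_mul₀ hsm]
  have e1 := Real.sq_sqrt hm.le
  have e2 := Real.sq_sqrt hp
  nlinarith [sq_nonneg (√m - √p)]

lemma aux_ind (φ : ℝ → ℝ) (hφ0 : ∀ x, 0 < x → 0 ≤ φ x)
    (hmono : MonotoneOn φ (Set.Ioi (0:ℝ))) (a : ℝ) (ha : 0 < a) (N : ℕ) :
    ENNReal.ofReal (∑ n ∈ Finset.Icc 1 (N+1), √(1 / (2 * (n : ℝ)) * φ (a / n)))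
      ≤ ENNReal.ofReal (√(a / 2)) * ∫⁻ u in Set.Ioi (a / ((N + 1 : ℕ) : ℝ)),
            ENNReal.ofReal (u ^ (-(3:ℝ)/2) * Real.sqrt (φ u)) := by
  induction N with
  | zero =>
    have hi := aux_piece φ hmono a ha (Set.Ioi a) measurableSet_Ioi subset_rfl _
      (integral_Ioi_rpow_of_lt (by norm_num) ha)
    rw [aux_rpow a ha] at hi
    have ht := aux_term a 1 0 (φ a) ha one_pos le_rfl (by norm_num) (hφ0 a ha)
    simp only [zero_add, Finset.Icc_self, Finset.sum_singleton, Nat.cast_one, div_one]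
    refine (ENNReal.ofReal_le_ofReal ht).trans ?_
    rw [ENNReal.ofReal_mul (by positivity)]
    gcongr
    refine le_trans (le_of_eq ?_) hi
    congr 2
    simp
    ring
  | succ N ih =>
    have hp : (0:ℝ) < ((N+1:ℕ):ℝ) := by positivity
    have hm : (0:ℝ) < ((N+1+1:ℕ):ℝ) := by positivity
    have hmp : ((N+1+1:ℕ):ℝ) = ((N+1:ℕ):ℝ) + 1 := by push_cast; ring
    rw [Finset.sum_Icc_succ_top (by omega)]
    generalize ((N+1:ℕ):ℝ) = p at *
    generalize ((N+1+1:ℕ):ℝ) = m at *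
    have hc : 0 < a / m := by positivity
    have hd : 0 < a / p := by positivity
    have hcd : a / m ≤ a / p := by gcongr; linarith
    have hval : ∫ u in Set.Ioc (a/m) (a/p), u ^ (-(3:ℝ)/2) = 2 * (√m - √p) / √a := by
      rw [← intervalIntegral.integral_of_le hcd, integral_rpow, aux_rpow _ hc, aux_rpow _ hd,
        Real.sqrt_div ha.le, Real.sqrt_div ha.le]
      · simp only [one_div_div]; ring
      · right
        refine ⟨by norm_num, ?_⟩
        rw [Set.uIcc_of_le hcd]
        exact fun h => absurd h.1 (not_le.2 hc)
    have hi := aux_piece φ hmono (a/m) hc (Set.Ioc (a/m) (a/p)) measurableSet_Ioc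
      (fun x hx => hx.1) _ hval
    have ht := aux_term a m p (φ (a/m)) ha hm hp.le hmp (hφ0 _ hc)
    rw [← Set.Ioc_union_Ioi_eq_Ioi hcd, lintegral_union measurableSet_Ioi
      (Set.Ioc_disjoint_Ioi le_rfl), mul_add, add_comm]
    refine ENNReal.ofReal_add_le.trans (add_le_add ?_ ih)
    refine (ENNReal.ofReal_le_ofReal ht).trans ?_
    rw [ENNReal.ofReal_mul (by positivity)]
    gcongr

/-- Sum–integral comparison for the exploration terms: for a non-decreasing function
`φ : (0, ∞) → [0, ∞)` vanishing on `(0,1]`, and integers `K ≥ 1`, `T ≥ K`,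
`∑_{n=1}^{⌊T/K⌋} √((1/(2n)) φ(T/(Kn))) ≤ √(T/(2K)) ∫_1^∞ u^{−3/2} √(φ(u)) du`. -/
theorem sum_sqrt_phi_le_integral (φ : ℝ → ℝ)
    (hφ0 : ∀ x, 0 < x → 0 ≤ φ x)
    (hmono : MonotoneOn φ (Set.Ioi (0:ℝ)))
    (hvanish : ∀ x ∈ Set.Ioc (0:ℝ) 1, φ x = 0)
    (K T : ℕ) (hK : 1 ≤ K) (hT : K ≤ T) :
    ENNReal.ofReal (∑ n ∈ Finset.Icc 1 (T / K),
        Real.sqrt (1 / (2 * (n : ℝ)) * φ ((T : ℝ) / (K * n))))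
      ≤ ENNReal.ofReal (Real.sqrt ((T : ℝ) / (2 * K))) *
          ∫⁻ u in Set.Ioi (1:ℝ),
            ENNReal.ofReal (u ^ (-(3:ℝ)/2) * Real.sqrt (φ u)) := by
  have hK0 : (0:ℝ) < K := by exact_mod_cast hK
  have hT0 : (0:ℝ) < T := by exact_mod_cast (by omega : 0 < T)
  have hN : 0 < T / K := Nat.div_pos hT hK
  obtain ⟨N, hN'⟩ := Nat.exists_eq_succ_of_ne_zero hN.ne'
  have h := aux_ind φ hφ0 hmono ((T:ℝ)/K) (by positivity) N
  rw [hN']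
  simp only [div_div, mul_comm (K:ℝ) 2] at h
  refine h.trans ?_
  gcongr
  rw [one_le_div (by positivity)]
  have : (N+1) * K ≤ T := by
    have := Nat.div_mul_le_self T K
    rwa [hN'] at this
  have h2 : (((N+1) * K : ℕ) : ℝ) ≤ T := by exact_mod_cast this
  push_cast at h2 ⊢
  linarith
end

section
/- Let φ(x) = ln_+( x (1 + ln_+²(x)) ) where ln_+ = max(ln, 0). Then for all δ > 0 and all integers K ≥ 1 and T ≥ K, Σ_{t=K}^{T−1} Σ_{n=1}^{⌊t/K⌋} e (2n + 1) exp( −2 n δ² − φ(t/(Kn)) ) ≤ e (3 + 8K) / (1 − e^{−2δ²})³. -/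
open Real

/-- The augmented exploration function `φ(x) = ln₊(x (1 + ln₊²(x)))`. -/
noncomputable def phiAug (x : ℝ) : ℝ :=
  max (Real.log (x * (1 + max (Real.log x) 0 ^ 2))) 0


lemma aux_phi (x : ℝ) (hx : 1 ≤ x) :
    Real.exp (-phiAug x) = (x * (1 + Real.log x ^ 2))⁻¹ := by
  have h0 : 0 ≤ Real.log x := Real.log_nonneg hx
  have h1 : 1 ≤ x * (1 + Real.log x ^ 2) := by nlinarith [sq_nonneg (Real.log x)]
  unfold phiAug
  rw [max_eq_left h0, max_eq_left (Real.log_nonneg h1), Real.exp_neg, Real.exp_log (by linarith)]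

lemma aux_mvt (a b : ℝ) (ha : 1 ≤ a) (hab : a < b) :
    (b - a) * (b * (1 + Real.log b ^ 2))⁻¹ ≤
      Real.arctan (Real.log b) - Real.arctan (Real.log a) := by
  have hd : ∀ s : ℝ, 1 ≤ s → HasDerivAt (fun s => Real.arctan (Real.log s))
      (1 / (1 + Real.log s ^ 2) * s⁻¹) s := by
    intro s hs
    exact (Real.hasDerivAt_log (by linarith)).arctan
  obtain ⟨c, hc, h⟩ := exists_hasDerivAt_eq_slope (fun s => Real.arctan (Real.log s))
    (fun s => 1 / (1 + Real.log s ^ 2) * s⁻¹) hab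
    (fun s hs => (hd s (ha.trans hs.1)).continuousAt.continuousWithinAt)
    (fun s hs => hd s (ha.trans hs.1.le))
  have hba : 0 < b - a := sub_pos.2 hab
  have hc1 : 1 ≤ c := ha.trans hc.1.le
  have hl0 : 0 ≤ Real.log c := Real.log_nonneg hc1
  have hl : Real.log c ≤ Real.log b := Real.log_le_log (by linarith) hc.2.le
  have key : (b * (1 + Real.log b ^ 2))⁻¹ ≤ 1 / (1 + Real.log c ^ 2) * c⁻¹ := by
    rw [one_div, ← mul_inv, mul_comm (1 + Real.log c ^ 2)]
    have := hc.2.le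
    have hb0 : 0 ≤ b := by linarith
    gcongr
  rw [eq_div_iff hba.ne'] at h
  rw [← h, mul_comm]
  gcongr

lemma aux_inner (m : ℕ) (hm : 1 ≤ m) (k : ℕ) :
    ∑ i ∈ Finset.range (k + 1), Real.exp (-phiAug (((m + i : ℕ) : ℝ) / m)) ≤
      1 + m * Real.arctan (Real.log (((m + k : ℕ) : ℝ) / m)) := by
  have hm0 : (0 : ℝ) < m := by exact_mod_cast hm
  induction k with
  | zero => simp [hm0.ne', aux_phi]
  | succ k ih =>
    rw [Finset.sum_range_succ]
    have h1 : (1 : ℝ) ≤ ((m + k : ℕ) : ℝ) / m := by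
      rw [le_div_iff₀ hm0]; push_cast; linarith [Nat.cast_nonneg (α := ℝ) k]
    have h2 : ((m + k : ℕ) : ℝ) / m < ((m + (k + 1) : ℕ) : ℝ) / m := by
      gcongr; omega
    have h := aux_mvt _ _ h1 h2
    rw [← aux_phi _ (h1.trans h2.le)] at h
    have h3 : ((m + (k + 1) : ℕ) : ℝ) / m - ((m + k : ℕ) : ℝ) / m = 1 / m := by
      rw [← sub_div]; push_cast; ring
    rw [h3, one_div, inv_mul_le_iff₀ hm0] at h
    linarith

lemma aux_inner2 (m T : ℕ) (hm : 1 ≤ m) :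
    ∑ t ∈ Finset.Ico m T, Real.exp (-phiAug ((t : ℝ) / m)) ≤ 1 + 2 * m := by
  have hm0 : (0 : ℝ) < m := by exact_mod_cast hm
  rw [Finset.sum_Ico_eq_sum_range]
  calc _ ≤ ∑ i ∈ Finset.range ((T - m) + 1), Real.exp (-phiAug (((m + i : ℕ) : ℝ) / m)) := by
        rw [Finset.sum_range_succ]
        linarith [Real.exp_pos (-phiAug (((m + (T - m) : ℕ) : ℝ) / m))]
    _ ≤ _ := aux_inner m hm _
    _ ≤ _ := by
        have h := Real.arctan_lt_pi_div_two (Real.log (((m + (T - m) : ℕ) : ℝ) / m))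
        have := Real.pi_lt_four
        nlinarith

/-- For all `δ > 0` and integers `K ≥ 1`, `T ≥ K`,
`∑_{t=K}^{T−1} ∑_{n=1}^{⌊t/K⌋} e (2n+1) exp(−2nδ² − φ(t/(Kn))) ≤ e (3+8K)/(1−e^{−2δ²})³`. -/
theorem double_sum_augmented_exploration (δ : ℝ) (hδ : 0 < δ)
    (K T : ℕ) (hK : 1 ≤ K) (hT : K ≤ T) :
    ∑ t ∈ Finset.Ico K T, ∑ n ∈ Finset.Icc 1 (t / K),
        Real.exp 1 * (2 * (n : ℝ) + 1) *
          Real.exp (-2 * n * δ ^ 2 - phiAug ((t : ℝ) / (K * n)))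
      ≤ Real.exp 1 * (3 + 8 * K) / (1 - Real.exp (-2 * δ ^ 2)) ^ 3 := by
  set r := Real.exp (-2 * δ ^ 2) with hr
  have hr0 : 0 < r := Real.exp_pos _
  have hr1 : r < 1 := by
    rw [hr, Real.exp_lt_one_iff]; nlinarith [sq_pos_of_pos hδ]
  have hswap : ∑ t ∈ Finset.Ico K T, ∑ n ∈ Finset.Icc 1 (t / K),
        Real.exp 1 * (2 * (n : ℝ) + 1) *
          Real.exp (-2 * n * δ ^ 2 - phiAug ((t : ℝ) / (K * n)))
      = ∑ n ∈ Finset.Ico 1 (T + 1), ∑ t ∈ Finset.Ico (K * n) T,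
        Real.exp 1 * (2 * (n : ℝ) + 1) *
          Real.exp (-2 * n * δ ^ 2 - phiAug ((t : ℝ) / (K * n))) := by
    apply Finset.sum_comm'
    intro t n
    simp only [Finset.mem_Ico, Finset.mem_Icc, Nat.le_div_iff_mul_le hK]
    constructor
    · rintro ⟨⟨h1, h2⟩, h3, h4⟩
      refine ⟨⟨by linarith, h2⟩, h3, ?_⟩
      nlinarith
    · rintro ⟨⟨h1, h2⟩, h3, h4⟩
      refine ⟨⟨by nlinarith, h2⟩, h3, by linarith⟩
  rw [hswap]
  have hK0 : (0 : ℝ) ≤ K := Nat.cast_nonneg K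
  have hs := (hasSum_choose_mul_geometric_of_norm_lt_one (𝕜 := ℝ) 2 (r := r)
    (by rw [Real.norm_of_nonneg hr0.le]; exact hr1)).mul_left (Real.exp 1 * (3 + 8 * K))
  rw [Finset.sum_Ico_eq_sum_range]
  calc _ ≤ ∑ j ∈ Finset.range (T + 1 - 1),
        Real.exp 1 * (3 + 8 * K) * (((j + 2).choose 2 : ℕ) * r ^ j) := ?_
    _ ≤ _ := sum_le_hasSum _ (fun j _ => by positivity) hs
    _ = _ := by ring
  apply Finset.sum_le_sum
  intro j _
  have hm : 1 ≤ K * (1 + j) := Nat.mul_pos hK (by omega)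
  have hin := aux_inner2 (K * (1 + j)) T hm
  have he : ∀ t : ℕ, Real.exp 1 * (2 * ((1 + j : ℕ) : ℝ) + 1) *
          Real.exp (-2 * ((1 + j : ℕ) : ℝ) * δ ^ 2 - phiAug ((t : ℝ) / (K * ((1 + j : ℕ) : ℝ))))
      = Real.exp 1 * (2 * ((1 + j : ℕ) : ℝ) + 1) * r ^ (1 + j) *
        Real.exp (-phiAug ((t : ℝ) / ((K * (1 + j) : ℕ) : ℝ))) := by
    intro t
    rw [hr, ← Real.exp_nat_mul, mul_assoc _ (Real.exp _) (Real.exp _), ← Real.exp_add]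
    push_cast
    ring_nf
  simp only [he]
  rw [← Finset.mul_sum]
  have hch : (((j + 2).choose 2 : ℕ) : ℝ) = (j + 1) * (j + 2) / 2 := by
    rw [Nat.cast_choose_two]; push_cast; ring
  have hj : (0 : ℝ) ≤ j := Nat.cast_nonneg j
  rw [hch]
  have hrj : r ^ (1 + j) ≤ r ^ j := pow_le_pow_of_le_one hr0.le hr1.le (by omega)
  calc _ ≤ Real.exp 1 * (2 * ((1 + j : ℕ) : ℝ) + 1) * r ^ j *
        (1 + 2 * ((K * (1 + j) : ℕ) : ℝ)) := by gcongr
    _ = Real.exp 1 * r ^ j * ((2 * j + 3) * (1 + 2 * (K * (1 + j)))) := by push_cast; ring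
    _ ≤ Real.exp 1 * r ^ j * ((3 + 8 * K) * ((j + 1) * (j + 2) / 2)) := by
        refine mul_le_mul_of_nonneg_left ?_ (by positivity)
        nlinarith [mul_nonneg hK0 hj, mul_nonneg hj hj]
    _ = _ := by ring
end

section
/- Let Z be a real random variable such that there exist a, b ≥ 0 with Z ≤ a almost surely and E[e^{−Z}] ≤ b, and set γ = √(e^a) (16 e^{−2} b + a²). Then Z is integrable, the log-moment generating function Λ(x) = ln E[e^{x Z}] is well defined (finite) for all x ∈ [−1, 1] and twice differentiable on (−1, 1), with Λ'(0) = E[Z] and Λ''(x) ≤ γ for all x ∈ [−1/2, 0]. -/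
open MeasureTheory Real ENNReal
open scoped Classical

/-- `γ = √(e^a) (16 e⁻² b + a²)`. -/
noncomputable def gam (a b : ℝ) : ℝ :=
  Real.sqrt (Real.exp a) * (16 * Real.exp (-2) * b + a ^ 2)

/-- Properties of the log-moment generating function `Λ(x) = ln E[e^{xZ}]` of a random
variable `Z` with `Z ≤ a` a.s. and `E[e^{−Z}] ≤ b`: `Z` is integrable, `Λ` is well defined
(the moment generating function is finite) on `[−1, 1]`, twice differentiable on `(−1, 1)`,
`Λ'(0) = E[Z]`, and `Λ''(x) ≤ γ` for `x ∈ [−1/2, 0]`. -/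
theorem log_mgf_properties {Ω : Type*} [MeasurableSpace Ω]
    (P : Measure Ω) [IsProbabilityMeasure P]
    (Z : Ω → ℝ) (hmeasZ : Measurable Z)
    (a b : ℝ) (ha : 0 ≤ a) (hb : 0 ≤ b)
    (hZa : ∀ᵐ ω ∂P, Z ω ≤ a)
    (hZb : ∫⁻ ω, ENNReal.ofReal (Real.exp (-(Z ω))) ∂P ≤ ENNReal.ofReal b) :
    Integrable Z P ∧
    (∀ x ∈ Set.Icc (-1 : ℝ) 1, Integrable (fun ω => Real.exp (x * Z ω)) P) ∧
    (∀ x ∈ Set.Ioo (-1 : ℝ) 1,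
      DifferentiableAt ℝ (fun y => Real.log (∫ ω, Real.exp (y * Z ω) ∂P)) x ∧
      DifferentiableAt ℝ (deriv fun y => Real.log (∫ ω, Real.exp (y * Z ω) ∂P)) x) ∧
    deriv (fun y => Real.log (∫ ω, Real.exp (y * Z ω) ∂P)) 0 = ∫ ω, Z ω ∂P ∧
    ∀ x ∈ Set.Icc (-(1:ℝ)/2) 0,
      deriv (deriv fun y => Real.log (∫ ω, Real.exp (y * Z ω) ∂P)) x ≤ gam a b := by
  have hmeas : ∀ x : ℝ, Measurable (fun ω => Real.exp (x * Z ω)) := fun x => by fun_prop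
  have hneg : Integrable (fun ω => Real.exp (-(Z ω))) P := by
    refine ⟨by fun_prop, ?_⟩
    rw [hasFiniteIntegral_iff_ofReal (Filter.Eventually.of_forall fun ω => (Real.exp_pos _).le)]
    exact lt_of_le_of_lt hZb ENNReal.ofReal_lt_top
  have hnegb : ∫ ω, Real.exp (-(Z ω)) ∂P ≤ b := by
    rw [integral_eq_lintegral_of_nonneg_ae
      (Filter.Eventually.of_forall fun ω => (Real.exp_pos _).le) (by fun_prop)]
    exact ENNReal.toReal_le_of_le_ofReal hb hZb
  have hint : ∀ x ∈ Set.Icc (-1 : ℝ) 1, Integrable (fun ω => Real.exp (x * Z ω)) P := by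
    intro x hx
    refine Integrable.mono' (hneg.add (integrable_const (Real.exp a)))
      (hmeas x).aestronglyMeasurable ?_
    filter_upwards [hZa] with ω hω
    rw [Real.norm_of_nonneg (Real.exp_pos _).le]
    simp only [Pi.add_apply]
    rcases le_total 0 (Z ω) with h | h
    · have : Real.exp (x * Z ω) ≤ Real.exp a := Real.exp_le_exp.2 (by nlinarith [hx.2])
      linarith [Real.exp_pos (-(Z ω))]
    · have : Real.exp (x * Z ω) ≤ Real.exp (-(Z ω)) := Real.exp_le_exp.2 (by nlinarith [hx.1])
      linarith [Real.exp_pos a]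
  have hsub : Set.Ioo (-1 : ℝ) 1 ⊆ interior (ProbabilityTheory.integrableExpSet Z P) :=
    interior_maximal (fun x hx => hint x (Set.Ioo_subset_Icc_self hx)) isOpen_Ioo
  have h0 : (0 : ℝ) ∈ interior (ProbabilityTheory.integrableExpSet Z P) :=
    hsub ⟨by norm_num, by norm_num⟩
  have hcgf : (fun y => Real.log (∫ ω, Real.exp (y * Z ω) ∂P)) = ProbabilityTheory.cgf Z P := rfl
  rw [hcgf]
  refine ⟨?_, hint, ?_, ?_, ?_⟩
  · simpa using ProbabilityTheory.integrable_pow_of_mem_interior_integrableExpSet h0 1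
  · intro x hx
    have h := ProbabilityTheory.analyticAt_cgf (hsub hx)
    exact ⟨h.differentiableAt, h.deriv.differentiableAt⟩
  · rw [ProbabilityTheory.deriv_cgf_zero h0]
    simp
  · intro x hx
    have hx1 : -(1 : ℝ) / 2 ≤ x := hx.1
    have hx2 : x ≤ 0 := hx.2
    have hxI : x ∈ interior (ProbabilityTheory.integrableExpSet Z P) :=
      hsub ⟨by linarith, by linarith⟩
    have h2 := ProbabilityTheory.iteratedDeriv_two_cgf hxI
    rw [iteratedDeriv_succ, iteratedDeriv_one] at h2
    rw [h2]
    have hi2 : Integrable (fun ω => (Z ω) ^ 2 * Real.exp (x * Z ω)) P :=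
      ProbabilityTheory.integrable_pow_mul_exp_of_mem_interior_integrableExpSet hxI 2
    have hnum : ∫ ω, (Z ω) ^ 2 * Real.exp (x * Z ω) ∂P ≤ 16 * Real.exp (-2) * b + a ^ 2 := by
      calc ∫ ω, (Z ω) ^ 2 * Real.exp (x * Z ω) ∂P
          ≤ ∫ ω, (16 * Real.exp (-2) * Real.exp (-(Z ω)) + a ^ 2) ∂P := by
            refine integral_mono_ae hi2 ((hneg.const_mul _).add (integrable_const _)) ?_
            filter_upwards [hZa] with ω hω
            rcases le_total 0 (Z ω) with h | h
            · have e1 : Real.exp (x * Z ω) ≤ 1 := Real.exp_le_one_iff.2 (by nlinarith)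
              have e2 : (Z ω) ^ 2 ≤ a ^ 2 := by nlinarith
              have e3 : (Z ω) ^ 2 * Real.exp (x * Z ω) ≤ (Z ω) ^ 2 :=
                mul_le_of_le_one_right (sq_nonneg _) e1
              have e4 : 0 < 16 * Real.exp (-2) * Real.exp (-(Z ω)) := by positivity
              linarith
            · have e1 : -(Z ω) / 4 ≤ Real.exp (-(Z ω) / 4 - 1) := by
                linarith [Real.add_one_le_exp (-(Z ω) / 4 - 1)]
              have e2 : (-(Z ω) / 4) ^ 2 ≤ Real.exp (-(Z ω) / 4 - 1) ^ 2 :=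
                pow_le_pow_left₀ (by linarith) e1 2
              have e3 : Real.exp (x * Z ω) ≤ Real.exp (-(Z ω) / 2) :=
                Real.exp_le_exp.2 (by nlinarith)
              have e4 : Real.exp (-(Z ω) / 4 - 1) ^ 2 * Real.exp (-(Z ω) / 2)
                  = Real.exp (-2) * Real.exp (-(Z ω)) := by
                rw [← Real.exp_nat_mul, ← Real.exp_add, ← Real.exp_add]
                congr 1
                push_cast
                ring
              have e5 := mul_le_mul e2 e3 (Real.exp_pos _).le (by positivity)
              rw [e4] at e5
              nlinarith [sq_nonneg a]
        _ = 16 * Real.exp (-2) * ∫ ω, Real.exp (-(Z ω)) ∂P + a ^ 2 := by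
            rw [integral_add (hneg.const_mul _) (integrable_const _), integral_const_mul]
            simp
        _ ≤ _ := by gcongr
    have hden : Real.exp (-(a / 2)) ≤ ProbabilityTheory.mgf Z P x := by
      have : ∫ _ω, Real.exp (-(a / 2)) ∂P ≤ ∫ ω, Real.exp (x * Z ω) ∂P := by
        refine integral_mono_ae (integrable_const _) (hint x ⟨by linarith, by linarith⟩) ?_
        filter_upwards [hZa] with ω hω
        exact Real.exp_le_exp.2 (by nlinarith)
      simpa [ProbabilityTheory.mgf] using this
    have hC : 0 ≤ 16 * Real.exp (-2) * b + a ^ 2 := by positivity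
    have hs : Real.sqrt (Real.exp a) = (Real.exp (-(a / 2)))⁻¹ := by
      rw [← Real.exp_neg, neg_neg, Real.exp_half]
    have : (∫ ω, (Z ω) ^ 2 * Real.exp (x * Z ω) ∂P) / ProbabilityTheory.mgf Z P x
        ≤ gam a b := by
      rw [gam, hs, mul_comm, ← div_eq_mul_inv]
      exact div_le_div₀ hC hnum (Real.exp_pos _) hden
    linarith [sq_nonneg (deriv (ProbabilityTheory.cgf Z P) x)]
end
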